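/- Let x ∈ ℂ^N be a nonzero vector. Then x satisfies both D x = x and B x = x (i.e., x is perfectly localized on both the vertex set S and the frequency set F) if and only if B D B x = x. Consequently, there exists a nontrivial vector perfectly localized on both S and F if and only if the operator B D B has an eigenvalue equal to one, and in that case every such x is an eigenvector of B D B associated with the unit eigenvalue. -/

import Mathlib

open Matrix

/-- The vertex-limiting projector `D = Diag(1_S)`. -/
noncomputable def vertexProj (N : ℕ) (S : Finset (Fin N)) : Matrix (Fin N) (Fin N) ℂ :=
  Matrix.diagonal (fun i => if i ∈ S then 1 else 0)

/-- The band-limiting projector `B = U Σ_F U*`. -/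
noncomputable def bandProj (N : ℕ) (U : Matrix (Fin N) (Fin N) ℂ) (F : Finset (Fin N)) :
    Matrix (Fin N) (Fin N) ℂ :=
  U * vertexProj N F * Uᴴ

/-- Application of a matrix to a vector of `EuclideanSpace ℂ (Fin N)`. -/
noncomputable def mapp {N : ℕ} (M : Matrix (Fin N) (Fin N) ℂ)
    (x : EuclideanSpace ℂ (Fin N)) : EuclideanSpace ℂ (Fin N) :=
  Matrix.toEuclideanCLM (𝕜 := ℂ) M x

theorem isStarProjection_vertexProj (N : ℕ) (S : Finset (Fin N)) :
    IsStarProjection (vertexProj N S) := by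
  refine ⟨?_, ?_⟩
  · simp [IsIdempotentElem, vertexProj, Matrix.diagonal_mul_diagonal]
  · rw [isSelfAdjoint_iff, vertexProj, Matrix.star_eq_conjTranspose, Matrix.diagonal_conjTranspose]
    congr 1
    ext i
    by_cases h : i ∈ S <;> simp [h]

theorem isStarProjection_bandProj (N : ℕ) {U : Matrix (Fin N) (Fin N) ℂ}
    (hU : U ∈ Matrix.unitaryGroup (Fin N) ℂ) (F : Finset (Fin N)) :
    IsStarProjection (bandProj N U F) := by
  have hF := isStarProjection_vertexProj N F
  have hUU : Uᴴ * U = 1 := Matrix.mem_unitaryGroup_iff'.mp hU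
  refine ⟨?_, hF.isSelfAdjoint.conjugate U⟩
  calc U * vertexProj N F * Uᴴ * (U * vertexProj N F * Uᴴ)
      = U * vertexProj N F * (Uᴴ * U) * vertexProj N F * Uᴴ := by simp only [mul_assoc]
    _ = U * vertexProj N F * Uᴴ := by
      rw [hUU, mul_one, mul_assoc U, hF.isIdempotentElem.eq]

/-- For orthogonal projections `P` and `Q`, the common fixed vectors are the fixed vectors
of `Q * P * Q`. -/
theorem IsStarProjection.apply_eq_and_apply_eq_iff {𝕜 E : Type*} [RCLike 𝕜]
    [NormedAddCommGroup E] [InnerProductSpace 𝕜 E] [CompleteSpace E] {P Q : E →L[𝕜] E}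
    (hP : IsStarProjection P) (hQ : IsStarProjection Q) (x : E) :
    (P x = x ∧ Q x = x) ↔ (Q * P * Q) x = x := by
  have hPP (y : E) : P (P y) = P y := DFunLike.congr_fun hP.isIdempotentElem.eq y
  have hQQ (y : E) : Q (Q y) = Q y := DFunLike.congr_fun hQ.isIdempotentElem.eq y
  have hPs := hP.isSelfAdjoint.isSymmetric
  have hQs := hQ.isSelfAdjoint.isSymmetric
  simp only [mul_apply_eq_comp]
  refine ⟨fun ⟨h₁, h₂⟩ => by rw [h₂, h₁, h₂], fun h => ?_⟩
  have hx : Q x = x := by rw [← h, hQQ]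
  rw [hx] at h
  refine ⟨?_, hx⟩
  have hxP : inner 𝕜 x (P x) = inner 𝕜 x x := by
    calc inner 𝕜 x (P x) = inner 𝕜 (Q x) (P x) := by rw [hx]
      _ = inner 𝕜 x (Q (P x)) := hQs x (P x)
      _ = inner 𝕜 x x := by rw [h]
  have hPx : inner 𝕜 (P x) x = inner 𝕜 x x := (hPs x x).trans hxP
  have hPPx : inner 𝕜 (P x) (P x) = inner 𝕜 x x :=
    (hPs x (P x)).trans (by rw [ContinuousLinearMap.coe_coe, hPP, hxP])
  rw [← sub_eq_zero, ← inner_self_eq_zero (𝕜 := 𝕜), inner_sub_sub_self, hPPx, hPx, hxP]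
  simp

theorem perfectly_localized_iff_BDB_fixed
    (N : ℕ) (hN : 0 < N) (U : Matrix (Fin N) (Fin N) ℂ)
    (hU : U ∈ Matrix.unitaryGroup (Fin N) ℂ) (S F : Finset (Fin N))
    (D B : Matrix (Fin N) (Fin N) ℂ)
    (hD : D = vertexProj N S) (hB : B = bandProj N U F) :
    (∀ x : EuclideanSpace ℂ (Fin N), x ≠ 0 →
      ((mapp D x = x ∧ mapp B x = x) ↔ mapp (B * D * B) x = x)) ∧
    ((∃ x : EuclideanSpace ℂ (Fin N), x ≠ 0 ∧ mapp D x = x ∧ mapp B x = x) ↔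
      (∃ x : EuclideanSpace ℂ (Fin N), x ≠ 0 ∧ mapp (B * D * B) x = x)) := by
  have key (x : EuclideanSpace ℂ (Fin N)) :
      (mapp D x = x ∧ mapp B x = x) ↔ mapp (B * D * B) x = x := by
    have h := IsStarProjection.apply_eq_and_apply_eq_iff
      ((isStarProjection_vertexProj N S).map (Matrix.toEuclideanCLM (𝕜 := ℂ)))
      ((isStarProjection_bandProj N hU F).map (Matrix.toEuclideanCLM (𝕜 := ℂ))) x
    rw [← map_mul, ← map_mul, ← hD, ← hB] at h
    exact h
  exact ⟨fun x _ => key x, exists_congr fun x => and_congr_right fun _ => key x⟩
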